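/- arXiv:2501.04554 — 2 statements merged into one kernel-verified Lean document; each statement's English description precedes it below -/
import Mathlib

section
/- For every p > 0 there exists a constant C = C(p) > 0 such that for all t > 0 and all x > c(p)√t one has C^{−1} V_{p−1}(x,t)(x − c(p)√t) ≤ V_p(x,t) ≤ C V_{p−1}(x,t)(x − c(p)√t). Moreover, if p > 1 there exists a constant A(p) > 0 such that A(p)^{−1} x^{p−1}(x − c(p)√t) ≤ V_p(x,t) ≤ A(p) x^{p−1}(x − c(p)√t) for all t > 0 and all x ≥ c(p)√t. -/
open MeasureTheory ProbabilityTheory Real Set Filter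
open scoped ENNReal NNReal ProbabilityTheory

noncomputable section

/-- Auxiliary recursion defining the functions `ψ_p`. -/
def psiAux : ℕ → ℝ → ℝ → ℝ
  | 0, p, x => (Real.Gamma (-p))⁻¹ *
      ∫ s in Set.Ioi (0 : ℝ), Real.exp (-x * s - s ^ 2 / 2) * s ^ (-p - 1)
  | (n + 1), p, x =>
      if p < 0 then
        (Real.Gamma (-p))⁻¹ *
          ∫ s in Set.Ioi (0 : ℝ), Real.exp (-x * s - s ^ 2 / 2) * s ^ (-p - 1)
      else x * psiAux n (p - 1) x + (1 - p) * psiAux n (p - 2) x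

/-- `ψ_p(x)`: for `p < 0` given by the integral representation
`ψ_p(x) = Γ(-p)⁻¹ ∫₀^∞ exp(-xs - s²/2) s^{-p-1} ds`; for `p ≥ 0` defined by iterating
the recurrence `ψ_p(x) = x ψ_{p-1}(x) + (1-p) ψ_{p-2}(x)`. -/
def psi (p x : ℝ) : ℝ := psiAux (⌈p⌉₊ + 1) p x

/-- `V_p(x,t) = t^{p/2} ψ_p(x/√t)` for `t > 0`, and `V_p(x,0) = x^p`. -/
def V (p x t : ℝ) : ℝ :=
  if t = 0 then x ^ p else t ^ (p / 2) * psi p (x / Real.sqrt t)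

/-- `c(p)`: the largest real zero of `ψ_p`. -/
def cRoot (p : ℝ) : ℝ := sSup {x : ℝ | psi p x = 0}

/-- `p(c)`: the minimal positive root of `p ↦ ψ_p(c)`. -/
def pRoot (c : ℝ) : ℝ := sInf {p : ℝ | 0 < p ∧ psi p c = 0}

/-- `V̄_p(x,t) = V_p(x,t)` if `x ≥ c(p)√t`, and `0` otherwise. -/
def Vbar (p x t : ℝ) : ℝ := if cRoot p * Real.sqrt t ≤ x then V p x t else 0

variable {Ω : Type*}

/-- The random walk `S(n) = X₁ + ⋯ + Xₙ` (with increments `X 0, X 1, …`). -/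
def S (X : ℕ → Ω → ℝ) (n : ℕ) (ω : Ω) : ℝ := ∑ i ∈ Finset.range n, X i ω

/-- The stopping time `T_{a,b} = inf {n ≥ 1 : a + S(n) ≤ c √(n+b)}`, valued in `ℕ∞`. -/
def hitT (c a b : ℝ) (X : ℕ → Ω → ℝ) (ω : Ω) : ℕ∞ :=
  sInf {m : ℕ∞ | ∃ k : ℕ, m = k ∧ 1 ≤ k ∧ a + S X k ω ≤ c * Real.sqrt ((k : ℝ) + b)}

/-- The unnormalised integral representing `ψ_{-a}`. -/
def psiIntegral (a x : ℝ) : ℝ :=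
  ∫ s in Set.Ioi (0 : ℝ), Real.exp (-x * s - s ^ 2 / 2) * s ^ (a - 1)

lemma exp_quadratic_le {R x s : ℝ} (hx : |x| ≤ R) (hs : 0 < s) :
    Real.exp (-x * s - s ^ 2 / 2) ≤ Real.exp ((R + 1) ^ 2 / 2) * Real.exp (-s) := by
  rw [← Real.exp_add, Real.exp_le_exp]
  have h1 : -x * s ≤ R * s :=
    mul_le_mul_of_nonneg_right ((neg_le_abs x).trans hx) hs.le
  nlinarith [sq_nonneg (s - (R + 1))]

lemma aestronglyMeasurable_psiIntegrand (a x : ℝ) :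
    AEStronglyMeasurable (fun s : ℝ => Real.exp (-x * s - s ^ 2 / 2) * s ^ (a - 1))
      (volume.restrict (Set.Ioi 0)) := by
  have : Measurable (fun s : ℝ => Real.exp (-x * s - s ^ 2 / 2) * s ^ (a - 1)) := by fun_prop
  exact this.aestronglyMeasurable

lemma integrableOn_exp_neg_dominant {a : ℝ} (ha : 0 < a) (R : ℝ) :
    IntegrableOn (fun s : ℝ => Real.exp ((R + 1) ^ 2 / 2) * (Real.exp (-s) * s ^ (a - 1)))
      (Set.Ioi 0) :=
  (Real.GammaIntegral_convergent ha).const_mul _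

lemma norm_psiIntegrand_le {a R x s : ℝ} (hx : |x| ≤ R) (hs : 0 < s) :
    ‖Real.exp (-x * s - s ^ 2 / 2) * s ^ (a - 1)‖ ≤
      Real.exp ((R + 1) ^ 2 / 2) * (Real.exp (-s) * s ^ (a - 1)) := by
  have h := Real.rpow_nonneg hs.le (a - 1)
  rw [Real.norm_of_nonneg (by positivity), ← mul_assoc]
  exact mul_le_mul_of_nonneg_right (exp_quadratic_le hx hs) h

lemma integrableOn_psiIntegrand {a : ℝ} (ha : 0 < a) (x : ℝ) :
    IntegrableOn (fun s : ℝ => Real.exp (-x * s - s ^ 2 / 2) * s ^ (a - 1)) (Set.Ioi 0) := by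
  refine Integrable.mono' (integrableOn_exp_neg_dominant ha |x|)
    (aestronglyMeasurable_psiIntegrand a x) ?_
  filter_upwards [ae_restrict_mem measurableSet_Ioi] with s hs
  exact norm_psiIntegrand_le le_rfl hs

lemma psiIntegral_pos {a : ℝ} (ha : 0 < a) (x : ℝ) : 0 < psiIntegral a x := by
  have h0 : ∀ s ∈ Set.Ioi (0 : ℝ), 0 < Real.exp (-x * s - s ^ 2 / 2) * s ^ (a - 1) :=
    fun s hs => mul_pos (Real.exp_pos _) (Real.rpow_pos_of_pos hs _)
  rw [psiIntegral, setIntegral_pos_iff_support_of_nonneg_ae _ (integrableOn_psiIntegrand ha x)]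
  · rw [Set.inter_eq_right.mpr fun s hs => Function.mem_support.mpr (h0 s hs).ne']
    simp
  · filter_upwards [ae_restrict_mem measurableSet_Ioi] with s hs
    exact (h0 s hs).le

lemma hasDerivAt_psiIntegral {a : ℝ} (ha : 0 < a) (x : ℝ) :
    HasDerivAt (psiIntegral a) (-psiIntegral (a + 1) x) x := by
  have key := hasDerivAt_integral_of_dominated_loc_of_deriv_le
    (μ := volume.restrict (Set.Ioi (0 : ℝ)))
    (F := fun x s : ℝ => Real.exp (-x * s - s ^ 2 / 2) * s ^ (a - 1))
    (F' := fun x s : ℝ => -(Real.exp (-x * s - s ^ 2 / 2) * s ^ (a + 1 - 1)))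
    (bound := fun s : ℝ =>
      Real.exp ((|x| + 1 + 1) ^ 2 / 2) * (Real.exp (-s) * s ^ (a + 1 - 1)))
    (Metric.ball_mem_nhds x one_pos)
    (Eventually.of_forall fun y => aestronglyMeasurable_psiIntegrand a y)
    (integrableOn_psiIntegrand ha x)
    (aestronglyMeasurable_psiIntegrand (a + 1) x).neg ?_
    (integrableOn_exp_neg_dominant (by linarith) _) ?_
  · have h := key.2
    rw [integral_neg] at h
    exact h
  · filter_upwards [ae_restrict_mem measurableSet_Ioi] with s hs y hy
    rw [norm_neg]
    refine norm_psiIntegrand_le ?_ hs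
    have h1 : |y - x| < 1 := by simpa [Real.dist_eq] using hy
    linarith [abs_sub_abs_le_abs_sub y x]
  · filter_upwards [ae_restrict_mem measurableSet_Ioi] with s hs y _
    have h1 : HasDerivAt (fun y : ℝ => -y * s - s ^ 2 / 2) (-s) y := by
      simpa using (((hasDerivAt_id y).neg.mul_const s).sub_const (s ^ 2 / 2))
    have h2 := (h1.exp.mul_const (s ^ (a - 1)))
    refine h2.congr_deriv ?_
    have : s ^ (a + 1 - 1) = s * s ^ (a - 1) := by
      rw [show a + 1 - 1 = 1 + (a - 1) by ring, Real.rpow_add hs, Real.rpow_one]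
    rw [this]
    ring

lemma tendsto_psiIntegrand_atTop (a x : ℝ) :
    Tendsto (fun s : ℝ => Real.exp (-x * s - s ^ 2 / 2) * s ^ (a - 1)) atTop (nhds 0) := by
  have h : Tendsto (fun s : ℝ => Real.exp ((|x| + 1) ^ 2 / 2) * (Real.exp (-s) * s ^ (a - 1)))
      atTop (nhds 0) := by
    have := (tendsto_rpow_mul_exp_neg_mul_atTop_nhds_zero (a - 1) 1 one_pos).const_mul
      (Real.exp ((|x| + 1) ^ 2 / 2))
    simpa [mul_comm] using this
  refine squeeze_zero_norm' ?_ h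
  filter_upwards [eventually_gt_atTop 0] with s hs
  exact norm_psiIntegrand_le le_rfl hs

lemma psiIntegral_recurrence {a : ℝ} (ha : 0 < a) (x : ℝ) :
    a * psiIntegral a x = x * psiIntegral (a + 1) x + psiIntegral (a + 2) x := by
  have i0 := (integrableOn_psiIntegrand ha x).const_mul a
  have i1 := (integrableOn_psiIntegrand (show 0 < a + 1 by linarith) x).const_mul x
  have i2 := integrableOn_psiIntegrand (show 0 < a + 2 by linarith) x
  have h := integral_Ioi_of_hasDerivAt_of_tendsto (a := 0) (m := 0)
    (f := fun s : ℝ => Real.exp (-x * s - s ^ 2 / 2) * s ^ (a + 1 - 1))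
    (f' := fun s : ℝ => a * (Real.exp (-x * s - s ^ 2 / 2) * s ^ (a - 1)) -
      (x * (Real.exp (-x * s - s ^ 2 / 2) * s ^ (a + 1 - 1)) +
        Real.exp (-x * s - s ^ 2 / 2) * s ^ (a + 2 - 1))) ?_ ?_ (i0.sub (i1.add i2))
    (tendsto_psiIntegrand_atTop _ x)
  · have e := integral_sub i0 (i1.add i2)
    simp only [Pi.add_apply] at e
    rw [e, integral_add i1 i2, integral_const_mul, integral_const_mul] at h
    simp only [add_sub_cancel_right, Real.zero_rpow ha.ne', mul_zero, sub_zero] at h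
    simp only [psiIntegral, add_sub_cancel_right]
    linarith
  · refine Continuous.continuousWithinAt ?_
    refine Continuous.mul (by fun_prop) ?_
    exact Real.continuous_rpow_const (by linarith)
  · intro s hs
    have hs : 0 < s := hs
    have h1 : HasDerivAt (fun s : ℝ => -x * s - s ^ 2 / 2) (-x - s) s := by
      refine (((hasDerivAt_id s).const_mul (-x)).sub
        (((hasDerivAt_id s).pow 2).div_const 2)).congr_deriv ?_
      simp
    have h2 := h1.exp.mul (Real.hasDerivAt_rpow_const (p := a + 1 - 1) (Or.inl hs.ne'))
    refine h2.congr_deriv ?_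
    have e2 : s ^ (a + 2 - 1) = s * s ^ (a + 1 - 1) := by
      rw [show a + 2 - 1 = 1 + (a + 1 - 1) by ring, Real.rpow_add hs, Real.rpow_one]
    rw [e2]
    simp only [add_sub_cancel_right]
    ring

lemma psiIntegral_le {a x : ℝ} (ha : 0 < a) (hx : 0 < x) :
    psiIntegral a x ≤ (1 / x) ^ a * Real.Gamma a := by
  rw [← Real.integral_rpow_mul_exp_neg_mul_Ioi ha hx]
  have hint : IntegrableOn (fun t : ℝ => t ^ (a - 1) * Real.exp (-(x * t))) (Set.Ioi 0) := by
    refine Integrable.of_integral_ne_zero ?_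
    rw [Real.integral_rpow_mul_exp_neg_mul_Ioi ha hx]
    have := Real.Gamma_pos_of_pos ha
    positivity
  refine setIntegral_mono_on (integrableOn_psiIntegrand ha x) hint measurableSet_Ioi ?_
  intro s hs
  rw [mul_comm]
  refine mul_le_mul_of_nonneg_left ?_ (Real.rpow_nonneg (le_of_lt hs) _)
  rw [Real.exp_le_exp]
  nlinarith [sq_nonneg s]

lemma le_psiIntegral {a x : ℝ} (ha : 0 < a) (hx : 0 < x) :
    (1 / x) ^ a * Real.Gamma a - 1 / 2 * ((1 / x) ^ (a + 2) * Real.Gamma (a + 2)) ≤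
      psiIntegral a x := by
  have hint : ∀ b : ℝ, 0 < b →
      IntegrableOn (fun t : ℝ => t ^ (b - 1) * Real.exp (-(x * t))) (Set.Ioi 0) := by
    intro b hb
    refine Integrable.of_integral_ne_zero ?_
    rw [Real.integral_rpow_mul_exp_neg_mul_Ioi hb hx]
    have := Real.Gamma_pos_of_pos hb
    positivity
  have i1 := hint a ha
  have i2 := (hint (a + 2) (by linarith)).const_mul (1 / 2)
  rw [← Real.integral_rpow_mul_exp_neg_mul_Ioi ha hx,
    ← Real.integral_rpow_mul_exp_neg_mul_Ioi (show 0 < a + 2 by linarith) hx,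
    ← integral_const_mul, ← integral_sub i1 i2]
  refine setIntegral_mono_on (i1.sub i2) (integrableOn_psiIntegrand ha x) measurableSet_Ioi ?_
  intro s hs
  have hs : 0 < s := hs
  have e2 : s ^ (a + 2 - 1) = s ^ 2 * s ^ (a - 1) := by
    rw [show a + 2 - 1 = 2 + (a - 1) by ring, Real.rpow_add hs, Real.rpow_two]
  have e3 : Real.exp (-x * s - s ^ 2 / 2) = Real.exp (-(s ^ 2 / 2)) * Real.exp (-(x * s)) := by
    rw [← Real.exp_add]
    ring_nf
  rw [e2, e3]
  have h := mul_le_mul_of_nonneg_right (Real.one_sub_le_exp_neg (s ^ 2 / 2))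
    (show 0 ≤ Real.exp (-(x * s)) * s ^ (a - 1) by positivity)
  linarith

lemma psiAux_eq_of_lt (n m : ℕ) {p : ℝ} (hn : p < n) (hm : p < m) (x : ℝ) :
    psiAux n p x = psiAux m p x := by
  induction n generalizing m p with
  | zero =>
    have hp : p < 0 := by simpa using hn
    cases m with
    | zero => rfl
    | succ m => simp [psiAux, hp]
  | succ n ih =>
    by_cases hp : p < 0
    · cases m with
      | zero => simp [psiAux, hp]
      | succ m => simp [psiAux, hp]
    · cases m with
      | zero => exact absurd (by simpa using hm) hp
      | succ m =>
        push_cast at hn hm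
        simp only [psiAux, hp, if_false]
        rw [ih m (p := p - 1) (by linarith) (by linarith),
          ih m (p := p - 2) (by linarith) (by linarith)]

lemma psiAux_eq_psi {n : ℕ} {p : ℝ} (hn : p < n) (x : ℝ) : psiAux n p x = psi p x := by
  refine psiAux_eq_of_lt n _ hn ?_ x
  push_cast
  linarith [Nat.le_ceil p]

lemma psi_of_neg {p : ℝ} (hp : p < 0) (x : ℝ) :
    psi p x = (Real.Gamma (-p))⁻¹ * psiIntegral (-p) x := by
  rw [← psiAux_eq_psi (n := 0) (by simpa using hp)]
  rfl

lemma psi_recurrence (p x : ℝ) : psi p x = x * psi (p - 1) x + (1 - p) * psi (p - 2) x := by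
  by_cases hp : p < 0
  · have h := psiIntegral_recurrence (neg_pos.mpr hp) x
    have g0 := Real.Gamma_pos_of_pos (neg_pos.mpr hp)
    have g1 : Real.Gamma (-(p - 1)) = -p * Real.Gamma (-p) := by
      rw [← Real.Gamma_add_one (by linarith)]
      ring_nf
    have g2 : Real.Gamma (-(p - 2)) = (1 - p) * (-p * Real.Gamma (-p)) := by
      rw [← g1, show (1 - p) = -(p - 1) by ring, ← Real.Gamma_add_one (by linarith)]
      ring_nf
    rw [psi_of_neg hp, psi_of_neg (by linarith), psi_of_neg (by linarith), g1, g2,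
      show -(p - 1) = -p + 1 by ring, show -(p - 2) = -p + 2 by ring]
    have h1 : 1 - p ≠ 0 := by linarith
    have h2 : p ≠ 0 := hp.ne
    have h3 := g0.ne'
    field_simp
    linarith
  · obtain ⟨n, hn⟩ := exists_nat_gt p
    rw [← psiAux_eq_psi (n := n + 1) (by push_cast; linarith),
      ← psiAux_eq_psi (n := n) (p := p - 1) (by linarith),
      ← psiAux_eq_psi (n := n) (p := p - 2) (by linarith)]
    simp [psiAux, hp]

lemma psi_pos_of_neg {p : ℝ} (hp : p < 0) (x : ℝ) : 0 < psi p x := by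
  rw [psi_of_neg hp]
  have := Real.Gamma_pos_of_pos (neg_pos.mpr hp)
  have := psiIntegral_pos (neg_pos.mpr hp) x
  positivity

lemma hasDerivAt_psi (p x : ℝ) : HasDerivAt (psi p) (p * psi (p - 1) x) x := by
  obtain ⟨n, hn⟩ := exists_nat_gt p
  have neg_case : ∀ p : ℝ, p < 0 → HasDerivAt (psi p) (p * psi (p - 1) x) x := by
    intro p hp
    have h := (hasDerivAt_psiIntegral (neg_pos.mpr hp) x).const_mul (Real.Gamma (-p))⁻¹
    rw [funext (psi_of_neg hp)]
    refine h.congr_deriv ?_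
    have g0 := (Real.Gamma_pos_of_pos (neg_pos.mpr hp)).ne'
    have g1 : Real.Gamma (-(p - 1)) = -p * Real.Gamma (-p) := by
      rw [← Real.Gamma_add_one (by linarith)]
      ring_nf
    rw [psi_of_neg (by linarith), g1, show -(p - 1) = -p + 1 by ring]
    have h2 : p ≠ 0 := hp.ne
    field_simp
  induction n generalizing p with
  | zero => exact neg_case p (by simpa using hn)
  | succ n ih =>
    push_cast at hn
    have d1 := ih (p - 1) (by linarith)
    have d2 := ih (p - 2) (by linarith)
    have h := ((hasDerivAt_id x).mul d1).add (d2.const_mul (1 - p))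
    have e : psi p = fun y => y * psi (p - 1) y + (1 - p) * psi (p - 2) y :=
      funext (psi_recurrence p)
    rw [e]
    refine h.congr_deriv ?_
    have r := psi_recurrence (p - 1) x
    simp only [id, show p - 1 - 1 = p - 2 by ring, show p - 1 - 2 = p - 3 by ring,
      show p - 2 - 1 = p - 3 by ring] at r ⊢
    linear_combination (1 - p) * r

lemma continuous_psi (p : ℝ) : Continuous (psi p) :=
  continuous_iff_continuousAt.mpr fun x => (hasDerivAt_psi p x).continuousAt

lemma tendsto_psi_div_rpow_of_neg {p : ℝ} (hp : p < 0) :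
    Tendsto (fun x => psi p x / x ^ p) atTop (nhds 1) := by
  have ha := neg_pos.mpr hp
  have g0 := Real.Gamma_pos_of_pos ha
  set K := 1 / 2 * Real.Gamma (-p + 2) / Real.Gamma (-p) with hK
  have hlow : Tendsto (fun x : ℝ => 1 - K * (x ^ 2)⁻¹) atTop (nhds 1) := by
    have := ((tendsto_inv_atTop_zero.comp (tendsto_pow_atTop (α := ℝ) two_ne_zero)).const_mul
      K).const_sub 1
    simpa using this
  refine tendsto_of_tendsto_of_tendsto_of_le_of_le' hlow tendsto_const_nhds ?_ ?_
  · filter_upwards [eventually_gt_atTop 0] with x hx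
    have hxp := Real.rpow_pos_of_pos hx p
    have h := le_psiIntegral ha hx
    have e1 : (1 / x) ^ (-p) = x ^ p := by
      rw [one_div, Real.inv_rpow hx.le, Real.rpow_neg hx.le, inv_inv]
    have e2 : (1 / x) ^ (-p + 2) = x ^ p * (x ^ 2)⁻¹ := by
      rw [Real.rpow_add (by positivity), e1, Real.rpow_two]
      simp
    rw [e1, e2] at h
    rw [le_div_iff₀ hxp, psi_of_neg hp, ← div_eq_inv_mul, le_div_iff₀ g0]
    refine le_of_eq_of_le ?_ h
    rw [hK]
    field_simp
  · filter_upwards [eventually_gt_atTop 0] with x hx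
    have hxp := Real.rpow_pos_of_pos hx p
    have h := psiIntegral_le ha hx
    have e1 : (1 / x) ^ (-p) = x ^ p := by
      rw [one_div, Real.inv_rpow hx.le, Real.rpow_neg hx.le, inv_inv]
    rw [e1] at h
    rw [div_le_one hxp, psi_of_neg hp, ← div_eq_inv_mul, div_le_iff₀ g0]
    exact h

lemma tendsto_psi_div_rpow (p : ℝ) : Tendsto (fun x => psi p x / x ^ p) atTop (nhds 1) := by
  obtain ⟨n, hn⟩ := exists_nat_gt p
  induction n generalizing p with
  | zero => exact tendsto_psi_div_rpow_of_neg (by simpa using hn)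
  | succ n ih =>
    push_cast at hn
    have t1 := ih (p - 1) (by linarith)
    have t2 := ih (p - 2) (by linarith)
    have h := t1.add ((((tendsto_inv_atTop_zero.comp
      (tendsto_pow_atTop (α := ℝ) two_ne_zero)).const_mul (1 - p))).mul t2)
    simp only [mul_zero, zero_mul, add_zero] at h
    refine h.congr' ?_
    filter_upwards [eventually_gt_atTop 0] with x hx
    have hxp := Real.rpow_pos_of_pos hx p
    rw [psi_recurrence p, Real.rpow_sub hx, Real.rpow_sub hx, Real.rpow_one, Real.rpow_two]
    simp only [Function.comp_apply]
    field_simp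

lemma tendsto_psi_atTop {p : ℝ} (hp : 0 < p) : Tendsto (psi p) atTop atTop := by
  have h := (tendsto_psi_div_rpow p).pos_mul_atTop one_pos (tendsto_rpow_atTop hp)
  refine h.congr' ?_
  filter_upwards [eventually_gt_atTop 0] with x hx
  have hxp := Real.rpow_pos_of_pos hx p
  field_simp

lemma psi_zero (x : ℝ) : psi 0 x = 1 := by
  have hconst : ∀ y, psi 0 y = psi 0 x := fun y =>
    is_const_of_deriv_eq_zero (fun z => (hasDerivAt_psi 0 z).differentiableAt)
      (fun z => by rw [(hasDerivAt_psi 0 z).deriv, zero_mul]) y x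
  have h := tendsto_psi_div_rpow 0
  simp only [Real.rpow_zero, div_one, hconst] at h
  exact tendsto_nhds_unique tendsto_const_nhds h

lemma psi_pos_of_nonpos {p : ℝ} (hp : p ≤ 0) (x : ℝ) : 0 < psi p x := by
  rcases hp.lt_or_eq with h | rfl
  · exact psi_pos_of_neg h x
  · simp [psi_zero]

lemma strictMonoOn_psi {p d : ℝ} (hp : 0 < p) (hd : ∀ x, d < x → 0 < psi (p - 1) x) :
    StrictMonoOn (psi p) (Set.Ici d) := by
  refine strictMonoOn_of_deriv_pos (convex_Ici d) (continuous_psi p).continuousOn ?_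
  intro x hx
  rw [interior_Ici] at hx
  rw [(hasDerivAt_psi p x).deriv]
  exact mul_pos hp (hd x hx)

/-- A sign change of `ψ_p` to the right of which `ψ_{p-1}` is positive gives a largest zero. -/
lemma exists_largest_zero {p d : ℝ} (hp : 0 < p) (hd : ∀ x, d < x → 0 < psi (p - 1) x)
    (hneg : psi p d < 0) : ∃ c, d < c ∧ psi p c = 0 ∧ ∀ x, c < x → 0 < psi p x := by
  obtain ⟨b, hb, hdb⟩ := (((tendsto_psi_atTop hp).eventually_gt_atTop 0).and
    (eventually_gt_atTop d)).exists
  obtain ⟨c, hc, hc0⟩ := intermediate_value_Icc hdb.le (continuous_psi p).continuousOn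
    ⟨hneg.le, hb.le⟩
  have hdc : d < c := lt_of_le_of_ne hc.1 (by rintro rfl; linarith)
  refine ⟨c, hdc, hc0, fun x hx => ?_⟩
  rw [← hc0]
  exact strictMonoOn_psi hp hd (Set.mem_Ici.mpr hdc.le) (Set.mem_Ici.mpr (hdc.trans hx).le) hx

lemma exists_psi_neg {p : ℝ} (hp : 0 < p) (hp1 : p ≤ 1) : ∃ d, psi p d < 0 := by
  have hq : p - 1 ≤ 0 := by linarith
  have anti : Antitone (psi (p - 1)) := by
    refine antitone_of_deriv_nonpos (fun z => (hasDerivAt_psi _ z).differentiableAt) fun z => ?_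
    rw [(hasDerivAt_psi _ z).deriv]
    exact mul_nonpos_of_nonpos_of_nonneg hq (psi_pos_of_nonpos (by linarith) z).le
  have m0 : 0 < p * psi (p - 1) 0 := mul_pos hp (psi_pos_of_nonpos hq 0)
  obtain ⟨d, hd0, hd⟩ : ∃ d : ℝ, d ≤ 0 ∧ psi p 0 + p * psi (p - 1) 0 * d < 0 := by
    refine ⟨-((|psi p 0| + 1) / (p * psi (p - 1) 0)), by
      rw [neg_nonpos]; positivity, ?_⟩
    rw [mul_neg, mul_div_cancel₀ _ m0.ne']
    linarith [le_abs_self (psi p 0)]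
  refine ⟨d, ?_⟩
  have := (convex_Iic (0 : ℝ)).mul_sub_le_image_sub_of_le_deriv (f := psi p)
    (C := p * psi (p - 1) 0) (continuous_psi p).continuousOn
    (fun z _ => (hasDerivAt_psi _ z).differentiableAt.differentiableWithinAt) (fun z hz => by
      rw [(hasDerivAt_psi _ z).deriv]
      exact mul_le_mul_of_nonneg_left (anti (Set.mem_Iic.mp (interior_subset hz))) hp.le)
    d hd0 0 (Set.mem_Iic.mpr le_rfl) hd0
  linarith

lemma exists_zero_with_sign {p : ℝ} (hp : 0 < p) :
    ∃ c, psi p c = 0 ∧ (∀ x, c < x → 0 < psi p x) ∧ (∀ x, c ≤ x → 0 < psi (p - 1) x) ∧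
      (1 < p → 0 < c) := by
  obtain ⟨n, hn⟩ := exists_nat_ge p
  induction n generalizing p with
  | zero => exact absurd hp (by simpa using hn)
  | succ n ih =>
    push_cast at hn
    rcases le_or_gt p 1 with hp1 | hp1
    · obtain ⟨d, hd⟩ := exists_psi_neg hp hp1
      have hpos : ∀ x, 0 < psi (p - 1) x := psi_pos_of_nonpos (by linarith)
      obtain ⟨c, _, hc0, hc⟩ := exists_largest_zero hp (fun x _ => hpos x) hd
      exact ⟨c, hc0, hc, fun x _ => hpos x, fun h => absurd h (by linarith)⟩
    · obtain ⟨d, hd0, hd1, hd2, hd3⟩ := ih (p := p - 1) (by linarith) (by linarith)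
      rw [show p - 1 - 1 = p - 2 by ring] at hd2
      have hneg : ∀ y, y * psi (p - 1) y = 0 → 0 < psi (p - 2) y → psi p y < 0 := by
        intro y hy hy2
        rw [psi_recurrence p, hy, zero_add]
        exact mul_neg_of_neg_of_pos (by linarith) hy2
      obtain ⟨c, hdc, hc0, hc⟩ := exists_largest_zero hp hd1
        (hneg d (by rw [hd0, mul_zero]) (hd2 d le_rfl))
      refine ⟨c, hc0, hc, fun x hx => hd1 x (hdc.trans_le hx), fun _ => ?_⟩
      rcases le_or_gt p 2 with hp2 | hp2
      · have h0 := hneg 0 (zero_mul _) (psi_pos_of_nonpos (by linarith) 0)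
        by_contra! hc'
        rcases hc'.lt_or_eq with h | h
        · exact absurd (hc 0 h) (by linarith)
        · rw [h] at hc0
          linarith
      · exact (hd3 (by linarith)).trans hdc

lemma cRoot_spec {p : ℝ} (hp : 0 < p) :
    psi p (cRoot p) = 0 ∧ (∀ x, cRoot p < x → 0 < psi p x) ∧
      (∀ x, cRoot p ≤ x → 0 < psi (p - 1) x) ∧ (1 < p → 0 < cRoot p) := by
  obtain ⟨c, hc0, hc⟩ := exists_zero_with_sign hp
  have : cRoot p = c := by
    refine IsGreatest.csSup_eq ⟨hc0, fun x hx => ?_⟩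
    by_contra! h
    exact (hc.1 x h).ne' hx
  rw [this]
  exact ⟨hc0, hc⟩

lemma exists_two_sided_bound {h : ℝ → ℝ} {c : ℝ} (hcont : ContinuousOn h (Set.Ici c))
    (hpos : ∀ x, c ≤ x → 0 < h x) (hlim : Tendsto h atTop (nhds 1)) :
    ∃ C : ℝ, 0 < C ∧ ∀ x, c ≤ x → C⁻¹ ≤ h x ∧ h x ≤ C := by
  have hlim' : ∀ᶠ x in atTop, (2 : ℝ)⁻¹ < h x ∧ h x < 2 :=
    (hlim.eventually (lt_mem_nhds (by norm_num))).and (hlim.eventually (gt_mem_nhds (by norm_num)))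
  obtain ⟨b, hb⟩ := eventually_atTop.mp hlim'
  have hc1 : ContinuousOn h (Set.Icc c b) := hcont.mono Set.Icc_subset_Ici_self
  obtain ⟨M, hM⟩ := isCompact_Icc.exists_bound_of_continuousOn hc1
  obtain ⟨N, hN⟩ := isCompact_Icc.exists_bound_of_continuousOn
    (hc1.inv₀ fun x hx => (hpos x hx.1).ne')
  have hC : 0 < max 2 (max M N) := lt_max_of_lt_left two_pos
  refine ⟨max 2 (max M N), hC, fun x hx => ?_⟩
  have hx0 := hpos x hx
  rw [inv_le_comm₀ hC hx0]
  rcases le_total b x with hbx | hbx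
  · obtain ⟨h1, h2⟩ := hb x hbx
    exact ⟨(inv_le_of_inv_le₀ two_pos h1.le).trans (le_max_left _ _),
      h2.le.trans (le_max_left _ _)⟩
  · have h1 := hM x ⟨hx, hbx⟩
    have h2 := hN x ⟨hx, hbx⟩
    exact ⟨((Real.le_norm_self _).trans h2).trans ((le_max_right _ _).trans (le_max_right _ _)),
      ((Real.le_norm_self _).trans h1).trans ((le_max_left _ _).trans (le_max_right _ _))⟩

/-- If `g` is positive and continuous on `[c(p), ∞)` and asymptotic to `x ^ (p - 1)`, then
`ψ_p` is comparable to `g x * (x - c(p))` there. -/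
lemma psi_comparison {p : ℝ} (hp : 0 < p) {g : ℝ → ℝ}
    (gcont : ContinuousOn g (Set.Ici (cRoot p))) (gpos : ∀ x, cRoot p ≤ x → 0 < g x)
    (glim : Tendsto (fun x => g x / x ^ (p - 1)) atTop (nhds 1)) :
    ∃ C : ℝ, 0 < C ∧ ∀ x, cRoot p ≤ x →
      C⁻¹ * (g x * (x - cRoot p)) ≤ psi p x ∧ psi p x ≤ C * (g x * (x - cRoot p)) := by
  obtain ⟨hc0, hc1, hc2, -⟩ := cRoot_spec hp
  set c := cRoot p with hc
  have hfac : ∀ x, psi p x = (x - c) * dslope (psi p) c x := fun x => by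
    have := sub_smul_dslope (psi p) c x
    rw [hc0, sub_zero, smul_eq_mul] at this
    exact this.symm
  have dcont : Continuous (dslope (psi p) c) := by
    rw [← continuousOn_univ, continuousOn_dslope univ_mem]
    exact ⟨(continuous_psi p).continuousOn, (hasDerivAt_psi p c).differentiableAt⟩
  have dpos : ∀ x, c ≤ x → 0 < dslope (psi p) c x := by
    intro x hx
    rcases hx.lt_or_eq with h | rfl
    · have h1 := hc1 x h
      rw [hfac x] at h1
      exact pos_of_mul_pos_right h1 (by linarith)
    · rw [dslope_same, (hasDerivAt_psi p c).deriv]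
      exact mul_pos hp (hc2 c le_rfl)
  have hlim : Tendsto (fun x => dslope (psi p) c x / g x) atTop (nhds 1) := by
    have l1 : Tendsto (fun x : ℝ => 1 - c * x⁻¹) atTop (nhds 1) := by
      simpa using (tendsto_inv_atTop_zero.const_mul c).const_sub 1
    have l2 := ((tendsto_psi_div_rpow p).div glim one_ne_zero).div l1 one_ne_zero
    simp only [div_one] at l2
    refine l2.congr' ?_
    filter_upwards [eventually_gt_atTop 0, eventually_gt_atTop c] with x hx hxc
    have hxp := Real.rpow_pos_of_pos hx p
    have hxc' : x - c ≠ 0 := by linarith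
    have hg := (gpos x hxc.le).ne'
    have e : 1 - c * x⁻¹ = (x - c) / x := by field_simp
    simp only [Pi.div_apply]
    rw [e, Real.rpow_sub hx, Real.rpow_one, hfac x]
    field_simp
  obtain ⟨C, hC, hb⟩ := exists_two_sided_bound
    (dcont.continuousOn.div gcont fun x hx => (gpos x hx).ne')
    (fun x hx => div_pos (dpos x hx) (gpos x hx)) hlim
  refine ⟨C, hC, fun x hx => ?_⟩
  obtain ⟨h1, h2⟩ := hb x hx
  have hg := gpos x hx
  rw [Pi.div_apply] at h1 h2
  rw [le_div_iff₀ hg] at h1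
  rw [div_le_iff₀ hg] at h2
  have hxc : 0 ≤ x - c := by linarith
  rw [hfac x]
  constructor
  · calc C⁻¹ * (g x * (x - c)) = (x - c) * (C⁻¹ * g x) := by ring
      _ ≤ _ := mul_le_mul_of_nonneg_left h1 hxc
  · calc (x - c) * dslope (psi p) c x ≤ (x - c) * (C * g x) :=
          mul_le_mul_of_nonneg_left h2 hxc
      _ = _ := by ring

lemma V_of_pos (p x : ℝ) {t : ℝ} (ht : 0 < t) :
    V p x t = t ^ (p / 2) * psi p (x / Real.sqrt t) := by
  simp [V, ht.ne']

lemma rpow_half_eq {t : ℝ} (ht : 0 < t) (p : ℝ) :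
    t ^ (p / 2) = t ^ ((p - 1) / 2) * Real.sqrt t := by
  rw [Real.sqrt_eq_rpow, ← Real.rpow_add ht]
  ring_nf

/-- Parabolic scaling turns a comparison for `ψ_p` into one for `V_p`. -/
lemma V_comparison_of_psi {p C x t B : ℝ} (ht : 0 < t) {b : ℝ}
    (hB : B = t ^ ((p - 1) / 2) * b)
    (h : C⁻¹ * (b * (x / Real.sqrt t - cRoot p)) ≤ psi p (x / Real.sqrt t) ∧
      psi p (x / Real.sqrt t) ≤ C * (b * (x / Real.sqrt t - cRoot p))) :
    C⁻¹ * (B * (x - cRoot p * Real.sqrt t)) ≤ V p x t ∧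
      V p x t ≤ C * (B * (x - cRoot p * Real.sqrt t)) := by
  have hs : 0 < Real.sqrt t := Real.sqrt_pos.mpr ht
  have e : B * (x - cRoot p * Real.sqrt t) =
      t ^ (p / 2) * (b * (x / Real.sqrt t - cRoot p)) := by
    rw [hB, rpow_half_eq ht p]
    field_simp
  have hk : 0 ≤ t ^ (p / 2) := Real.rpow_nonneg ht.le _
  rw [V_of_pos p x ht, e, mul_left_comm, mul_left_comm C]
  exact ⟨mul_le_mul_of_nonneg_left h.1 hk, mul_le_mul_of_nonneg_left h.2 hk⟩

/-- Lemma 2: two-sided comparison of `V_p` with `V_{p-1}(x,t)(x - c(p)√t)`, and,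
for `p > 1`, with `x^{p-1}(x - c(p)√t)`. -/
theorem V_boundary_comparison (p : ℝ) (hp : 0 < p) :
    (∃ C : ℝ, 0 < C ∧ ∀ t : ℝ, 0 < t → ∀ x : ℝ, cRoot p * Real.sqrt t < x →
      C⁻¹ * (V (p - 1) x t * (x - cRoot p * Real.sqrt t)) ≤ V p x t ∧
      V p x t ≤ C * (V (p - 1) x t * (x - cRoot p * Real.sqrt t))) ∧
    (1 < p → ∃ A : ℝ, 0 < A ∧ ∀ t : ℝ, 0 < t → ∀ x : ℝ, cRoot p * Real.sqrt t ≤ x →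
      A⁻¹ * (x ^ (p - 1) * (x - cRoot p * Real.sqrt t)) ≤ V p x t ∧
      V p x t ≤ A * (x ^ (p - 1) * (x - cRoot p * Real.sqrt t))) := by
  obtain ⟨-, -, hpos, hc⟩ := cRoot_spec hp
  refine ⟨?_, fun hp1 => ?_⟩
  · obtain ⟨C, hC, h⟩ := psi_comparison hp (continuous_psi (p - 1)).continuousOn hpos
      (tendsto_psi_div_rpow (p - 1))
    refine ⟨C, hC, fun t ht x hx => ?_⟩
    refine V_comparison_of_psi ht (V_of_pos (p - 1) x ht) (h _ ?_)
    rw [le_div_iff₀ (Real.sqrt_pos.mpr ht)]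
    exact hx.le
  · have hc := hc hp1
    obtain ⟨A, hA, h⟩ := psi_comparison hp (g := fun x => x ^ (p - 1))
      (Real.continuous_rpow_const (by linarith)).continuousOn
      (fun x hx => Real.rpow_pos_of_pos (hc.trans_le hx) _) (by
        refine tendsto_const_nhds.congr' ?_
        filter_upwards [eventually_gt_atTop 0] with x hx
        exact (div_self (Real.rpow_pos_of_pos hx _).ne').symm)
    refine ⟨A, hA, fun t ht x hx => ?_⟩
    have hs := Real.sqrt_pos.mpr ht
    have hcx : cRoot p ≤ x / Real.sqrt t := by
      rw [le_div_iff₀ hs]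
      exact hx
    refine V_comparison_of_psi ht ?_ (h _ hcx)
    have e : t ^ ((p - 1) / 2) = Real.sqrt t ^ (p - 1) := by
      rw [Real.sqrt_eq_rpow, ← Real.rpow_mul ht.le]
      ring_nf
    rw [e, ← Real.mul_rpow hs.le (hc.le.trans hcx), mul_div_cancel₀ _ hs.ne']
end
end

section
/- Let X be a real random variable with E X = 0, E X² = 1 and E|X|^{2+δ} < ∞, where p ∈ (0,1) and 0 < δ < p. For every γ > 0 there exist constants C > 0 and R > 0 such that, with g(x,t) := max( V̄_p(x+R, t+R) − C (t+R)^{(p−δ)/2}, 0 ), one has E[g(x+X, t+1)] ≤ g(x,t) for all t ≥ 0 and all x ≥ (c(p)+γ)√t. -/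
open MeasureTheory ProbabilityTheory Real Set Filter
open scoped ENNReal NNReal ProbabilityTheory

noncomputable section

variable {Ω : Type*}

/-- The weighted Gaussian moment `∫₀^∞ s^r exp(-ys - τs²/2) ds`. -/
def gaussMoment (r y τ : ℝ) : ℝ :=
  ∫ s in Ioi (0 : ℝ), s ^ r * Real.exp (-y * s - τ * s ^ 2 / 2)

theorem gaussMoment_integrand_le {r y τ a s : ℝ} (hs : 0 < s) (hτ : 0 < τ)
    (hy : -(a * Real.sqrt τ) ≤ y) :
    s ^ r * Real.exp (-y * s - τ * s ^ 2 / 2)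
      ≤ Real.exp (a ^ 2) * (s ^ r * Real.exp (-(τ / 4) * s ^ 2)) := by
  have h1 : Real.exp (-y * s - τ * s ^ 2 / 2)
      ≤ Real.exp (a ^ 2) * Real.exp (-(τ / 4) * s ^ 2) := by
    rw [← Real.exp_add]
    apply Real.exp_le_exp.2
    have h2 := Real.sq_sqrt hτ.le
    nlinarith [mul_le_mul_of_nonneg_right hy hs.le, sq_nonneg (a - Real.sqrt τ * s / 2)]
  calc _ ≤ s ^ r * (Real.exp (a ^ 2) * Real.exp (-(τ / 4) * s ^ 2)) :=
        mul_le_mul_of_nonneg_left h1 (Real.rpow_nonneg hs.le _)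
    _ = _ := by ring

theorem integrableOn_gaussMoment {r τ : ℝ} (y : ℝ) (hr : -1 < r) (hτ : 0 < τ) :
    IntegrableOn (fun s : ℝ => s ^ r * Real.exp (-y * s - τ * s ^ 2 / 2)) (Ioi 0) := by
  have hg := (integrableOn_rpow_mul_exp_neg_mul_sq (b := τ / 4) (by positivity) hr).const_mul
    (Real.exp ((|y| / Real.sqrt τ) ^ 2))
  refine Integrable.mono' hg (by fun_prop) ?_
  filter_upwards [ae_restrict_mem measurableSet_Ioi] with s hs
  have hs : 0 < s := hs
  rw [Real.norm_of_nonneg (by positivity)]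
  apply gaussMoment_integrand_le hs hτ
  rw [div_mul_cancel₀ _ (Real.sqrt_pos.2 hτ).ne']
  exact neg_abs_le y

theorem gaussMoment_nonneg (r y τ : ℝ) : 0 ≤ gaussMoment r y τ :=
  setIntegral_nonneg measurableSet_Ioi fun s hs => by
    have hs : 0 < s := hs
    positivity

theorem exists_gaussMoment_le {r : ℝ} (hr : -1 < r) (b : ℝ) :
    ∃ A : ℝ, 0 ≤ A ∧ ∀ τ y : ℝ, 0 < τ → b * Real.sqrt τ ≤ y →
      gaussMoment r y τ ≤ A * τ ^ (-(r + 1) / 2) := by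
  refine ⟨Real.exp ((-b) ^ 2) * ((1 / 4) ^ (-(r + 1) / 2) * (1 / 2)
    * Real.Gamma ((r + 1) / 2)), ?_, fun τ y hτ hy => ?_⟩
  · have := Real.Gamma_pos_of_pos (s := (r + 1) / 2) (by linarith)
    positivity
  · have hint : IntegrableOn (fun s : ℝ => s ^ r * Real.exp (-(τ / 4) * s ^ 2)) (Ioi 0) :=
      integrableOn_rpow_mul_exp_neg_mul_sq (by positivity) hr
    calc gaussMoment r y τ
        ≤ ∫ s in Ioi (0 : ℝ),
            Real.exp ((-b) ^ 2) * (s ^ r * Real.exp (-(τ / 4) * s ^ 2)) := by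
          refine setIntegral_mono_on (integrableOn_gaussMoment y hr hτ) (hint.const_mul _)
            measurableSet_Ioi fun s hs => ?_
          exact gaussMoment_integrand_le hs hτ (by linarith)
      _ = _ := by
          rw [integral_const_mul]
          have h := integral_rpow_mul_exp_neg_mul_rpow (p := 2) (q := r) (b := τ / 4)
            two_pos hr (by positivity)
          simp only [Real.rpow_two] at h
          rw [h, div_eq_mul_one_div τ 4, Real.mul_rpow hτ.le (by norm_num)]
          ring

/-- The integral representing `V_p` for `p ∈ (0,1)`, up to a constant factor. -/
def heatIntegral (p x t : ℝ) : ℝ :=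
  ∫ s in Ioi (0 : ℝ), s ^ (-p - 1) * (1 - Real.exp (-x * s - t * s ^ 2 / 2))

theorem abs_one_sub_exp_neg_le (u : ℝ) :
    |1 - Real.exp (-u)| ≤ |u| * (1 + Real.exp (-u)) := by
  have h1 := Real.add_one_le_exp (-u)
  have h2 := Real.add_one_le_exp u
  have h3 : Real.exp u * Real.exp (-u) = 1 := by rw [← Real.exp_add]; simp
  have h4 := Real.exp_pos (-u)
  rcases le_total 0 u with h | h
  · have h5 := Real.exp_le_one_iff.2 (neg_nonpos.2 h)
    rw [abs_of_nonneg h, abs_of_nonneg (by linarith)]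
    nlinarith
  · have h5 := Real.one_le_exp (neg_nonneg.2 h)
    rw [abs_of_nonpos h, abs_of_nonpos (by linarith)]
    nlinarith

theorem abs_one_sub_exp_le_of_le_one (x : ℝ) {t s : ℝ} (ht : 0 ≤ t) (hs : 0 ≤ s) (hs1 : s ≤ 1) :
    |1 - Real.exp (-x * s - t * s ^ 2 / 2)|
      ≤ (|x| + t / 2) * (1 + Real.exp |x|) * s := by
  have h := abs_one_sub_exp_neg_le (x * s + t * s ^ 2 / 2)
  have e : -(x * s + t * s ^ 2 / 2) = -x * s - t * s ^ 2 / 2 := by ring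
  rw [e] at h
  have h1 : |x * s + t * s ^ 2 / 2| ≤ (|x| + t / 2) * s := by
    calc _ ≤ |x * s| + |t * s ^ 2 / 2| := abs_add_le _ _
      _ = |x| * s + t * s ^ 2 / 2 := by
        rw [abs_mul, abs_of_nonneg hs, abs_of_nonneg (by positivity : 0 ≤ t * s ^ 2 / 2)]
      _ ≤ _ := by nlinarith [mul_nonneg ht (mul_nonneg hs (sub_nonneg.2 hs1))]
  have h2 : Real.exp (-x * s - t * s ^ 2 / 2) ≤ Real.exp |x| := by
    apply Real.exp_le_exp.2
    nlinarith [neg_abs_le x, abs_nonneg x, mul_nonneg ht (sq_nonneg s),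
      mul_nonneg (abs_nonneg x) (sub_nonneg.2 hs1),
      mul_nonneg (by linarith [neg_abs_le x] : 0 ≤ x + |x|) hs]
  calc _ ≤ _ := h
    _ ≤ ((|x| + t / 2) * s) * (1 + Real.exp |x|) := by gcongr
    _ = _ := by ring

theorem integrableOn_heatIntegral {p t : ℝ} (hp0 : 0 < p) (hp1 : p < 1) (x : ℝ) (ht : 0 < t) :
    IntegrableOn (fun s : ℝ => s ^ (-p - 1) * (1 - Real.exp (-x * s - t * s ^ 2 / 2)))
      (Ioi 0) := by
  rw [← Ioc_union_Ioi_eq_Ioi zero_le_one]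
  refine IntegrableOn.union ?_ ?_
  · have hg : IntegrableOn (fun s : ℝ => s ^ (-p)) (Ioc 0 1) := by
      have := intervalIntegral.intervalIntegrable_rpow' (a := 0) (b := 1) (r := -p) (by linarith)
      rwa [intervalIntegrable_iff, uIoc_of_le zero_le_one] at this
    refine Integrable.mono' (hg.const_mul ((|x| + t / 2) * (1 + Real.exp |x|)))
      (by fun_prop) ?_
    filter_upwards [ae_restrict_mem measurableSet_Ioc] with s hs
    have hs0 : 0 < s := hs.1
    rw [norm_mul, Real.norm_of_nonneg (by positivity), Real.norm_eq_abs]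
    calc _ ≤ s ^ (-p - 1) * ((|x| + t / 2) * (1 + Real.exp |x|) * s) := by
          gcongr; exact abs_one_sub_exp_le_of_le_one x ht.le hs0.le hs.2
      _ = _ := by
          rw [Real.rpow_sub_one hs0.ne']; field_simp
  · have hg1 : IntegrableOn (fun s : ℝ => s ^ (-p - 1)) (Ioi 1) :=
      integrableOn_Ioi_rpow_of_lt (by linarith) one_pos
    have hg2 : IntegrableOn (fun s : ℝ => s ^ (0 : ℝ) * Real.exp (-x * s - t * s ^ 2 / 2))
        (Ioi 1) :=
      (integrableOn_gaussMoment x (by norm_num) ht).mono_set (Ioi_subset_Ioi zero_le_one)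
    refine Integrable.mono' (hg1.add hg2) (by fun_prop) ?_
    filter_upwards [ae_restrict_mem measurableSet_Ioi] with s hs
    have hs1 : 1 < s := hs
    have hs0 : 0 < s := by linarith
    rw [norm_mul, Real.norm_of_nonneg (by positivity), Real.norm_eq_abs]
    have h1 : s ^ (-p - 1) ≤ 1 := Real.rpow_le_one_of_one_le_of_nonpos hs1.le (by linarith)
    have h2 := Real.exp_pos (-x * s - t * s ^ 2 / 2)
    have h3 : |1 - Real.exp (-x * s - t * s ^ 2 / 2)| ≤ 1 + Real.exp (-x * s - t * s ^ 2 / 2) := by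
      rw [abs_le]; constructor <;> linarith
    have h4 : 0 ≤ s ^ (-p - 1) := by positivity
    simp only [Pi.add_apply, Real.rpow_zero, one_mul]
    nlinarith

/-- Integration by parts for the integral representation of `ψ_p`. -/
theorem mul_heatIntegral_one {p : ℝ} (hp0 : 0 < p) (hp1 : p < 1) (x : ℝ) :
    p * heatIntegral p x 1 = x * gaussMoment (-p) x 1 + gaussMoment (1 - p) x 1 := by
  set E : ℝ → ℝ := fun s => Real.exp (-x * s - 1 * s ^ 2 / 2) with hE
  set H : ℝ → ℝ := fun s => s ^ (-p) * (1 - E s) with hH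
  have i0 := (integrableOn_heatIntegral hp0 hp1 x one_pos).const_mul p
  have i1 := (integrableOn_gaussMoment (r := -p) x (by linarith) one_pos).const_mul x
  have i2 := integrableOn_gaussMoment (r := 1 - p) x (by linarith) one_pos
  have hderiv : ∀ s ∈ Ioi (0 : ℝ), HasDerivAt H
      ((x * (s ^ (-p) * E s) + s ^ (1 - p) * E s) - p * (s ^ (-p - 1) * (1 - E s))) s := by
    intro s hs
    have hs : 0 < s := hs
    have d1 : HasDerivAt (fun s : ℝ => s ^ (-p)) (-p * s ^ (-p - 1)) s :=
      Real.hasDerivAt_rpow_const (Or.inl hs.ne')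
    have d2 : HasDerivAt (fun s : ℝ => -x * s - 1 * s ^ 2 / 2) (-x - s) s := by
      have := ((hasDerivAt_id' s).const_mul (-x)).sub
        (((hasDerivAt_pow 2 s).const_mul 1).div_const 2)
      refine this.congr_deriv ?_
      push_cast; ring
    refine (d1.mul (d2.exp.const_sub 1)).congr_deriv ?_
    have : s ^ (1 - p) = s ^ (-p) * s := by
      rw [← Real.rpow_add_one hs.ne']; congr 1; ring
    rw [this]; simp only [hE]; ring
  have hzero : H 0 = 0 := by simp [hH, hE]
  have hcont : ContinuousWithinAt H (Ici 0) 0 := by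
    rw [ContinuousWithinAt, hzero]
    have hlim : Tendsto (fun s : ℝ => (|x| + 1 / 2) * (1 + Real.exp |x|) * s ^ (1 - p))
        (nhdsWithin 0 (Ici 0)) (nhds 0) := by
      have : ContinuousAt (fun s : ℝ => (|x| + 1 / 2) * (1 + Real.exp |x|) * s ^ (1 - p)) 0 :=
        (Real.continuousAt_rpow_const _ _ (Or.inr (by linarith))).const_mul _
      have h := this.tendsto.mono_left (nhdsWithin_le_nhds (s := Ici 0))
      simpa [Real.zero_rpow (by linarith : 1 - p ≠ 0)] using h
    refine squeeze_zero_norm' ?_ hlim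
    have hmem : Iio (1 : ℝ) ∈ nhdsWithin (0 : ℝ) (Ici 0) :=
      mem_nhdsWithin_of_mem_nhds (Iio_mem_nhds one_pos)
    filter_upwards [hmem, self_mem_nhdsWithin] with s hs1 hs0
    rcases (show 0 ≤ s from hs0).eq_or_lt with rfl | hs
    · rw [hzero, Real.zero_rpow (by linarith)]; simp
    · rw [hH, norm_mul, Real.norm_of_nonneg (by positivity), Real.norm_eq_abs]
      calc _ ≤ s ^ (-p) * ((|x| + 1 / 2) * (1 + Real.exp |x|) * s) := by
            gcongr
            exact abs_one_sub_exp_le_of_le_one x zero_le_one hs.le (le_of_lt hs1)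
        _ = _ := by
            have : s ^ (1 - p) = s ^ (-p) * s := by
              rw [← Real.rpow_add_one hs.ne']; congr 1; ring
            rw [this]; ring
  have hinf : Tendsto H atTop (nhds 0) := by
    refine squeeze_zero_norm' ?_ (tendsto_rpow_neg_atTop hp0)
    filter_upwards [eventually_gt_atTop (0 : ℝ), eventually_ge_atTop (2 * |x|)] with s hs hsx
    rw [hH, norm_mul, Real.norm_of_nonneg (by positivity), Real.norm_eq_abs]
    have h1 : E s ≤ 1 := by
      apply Real.exp_le_one_iff.2
      nlinarith [neg_abs_le x, abs_nonneg x]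
    have h2 : 0 < E s := Real.exp_pos _
    have h3 : |1 - E s| ≤ 1 := by rw [abs_le]; constructor <;> linarith
    exact mul_le_of_le_one_right (by positivity) h3
  have key := integral_Ioi_of_hasDerivAt_of_tendsto hcont hderiv ((i1.add i2).sub i0) hinf
  have hsum : ∫ s in Ioi (0 : ℝ),
      ((x * (s ^ (-p) * E s) + s ^ (1 - p) * E s) - p * (s ^ (-p - 1) * (1 - E s)))
      = (x * gaussMoment (-p) x 1 + gaussMoment (1 - p) x 1) - p * heatIntegral p x 1 := by
    simp only [heatIntegral, gaussMoment]
    rw [← integral_const_mul, ← integral_const_mul, ← integral_add i1 i2]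
    exact integral_sub (i1.add i2) i0
  rw [hsum, hzero] at key
  linarith

theorem psi_eq_heatIntegral {p : ℝ} (hp0 : 0 < p) (hp1 : p < 1) (x : ℝ) :
    psi p x = p / Real.Gamma (1 - p) * heatIntegral p x 1 := by
  have hc : ⌈p⌉₊ = 1 := by
    rw [Nat.ceil_eq_iff one_ne_zero]; simp; exact ⟨hp0, hp1.le⟩
  have hG : Real.Gamma (1 - p) ≠ 0 := (Real.Gamma_pos_of_pos (by linarith)).ne'
  have hG2 : Real.Gamma (2 - p) = (1 - p) * Real.Gamma (1 - p) := by
    rw [← Real.Gamma_add_one (by linarith : 1 - p ≠ 0)]; congr 1; ring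
  have e1 : ∫ s in Ioi (0 : ℝ), Real.exp (-x * s - s ^ 2 / 2) * s ^ (-(p - 1) - 1)
      = gaussMoment (-p) x 1 := by
    rw [gaussMoment]; congr 1; ext s; rw [one_mul, mul_comm]; congr 2; ring
  have e2 : ∫ s in Ioi (0 : ℝ), Real.exp (-x * s - s ^ 2 / 2) * s ^ (-(p - 2) - 1)
      = gaussMoment (1 - p) x 1 := by
    rw [gaussMoment]; congr 1; ext s; rw [one_mul, mul_comm]; congr 2; ring
  have hp' : ¬ p < 0 := by linarith
  have hp1' : p - 1 < 0 := by linarith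
  have hp2' : p - 2 < 0 := by linarith
  have f1 : -(p - 1) = 1 - p := by ring
  have f2 : -(p - 2) = 2 - p := by ring
  rw [psi, hc]
  simp only [psiAux, hp', hp1', hp2', if_true, if_false]
  rw [e1, e2, f1, f2, hG2, div_mul_eq_mul_div, mul_heatIntegral_one hp0 hp1]
  have : 1 - p ≠ 0 := by linarith
  field_simp

theorem heatIntegral_scale {p t : ℝ} (x : ℝ) (ht : 0 < t) :
    heatIntegral p x t = t ^ (p / 2) * heatIntegral p (x / Real.sqrt t) 1 := by
  have hst : 0 < Real.sqrt t := Real.sqrt_pos.2 ht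
  have h := integral_comp_mul_left_Ioi
    (fun s : ℝ => s ^ (-p - 1) * (1 - Real.exp (-(x / Real.sqrt t) * s - 1 * s ^ 2 / 2))) 0 hst
  rw [mul_zero, smul_eq_mul] at h
  have h2 : ∫ s in Ioi (0 : ℝ), (Real.sqrt t * s) ^ (-p - 1) *
      (1 - Real.exp (-(x / Real.sqrt t) * (Real.sqrt t * s) - 1 * (Real.sqrt t * s) ^ 2 / 2))
      = Real.sqrt t ^ (-p - 1) * heatIntegral p x t := by
    rw [heatIntegral, ← integral_const_mul]
    refine setIntegral_congr_fun measurableSet_Ioi fun s hs => ?_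
    have hs : 0 < s := hs
    rw [Real.mul_rpow hst.le hs.le, mul_pow, Real.sq_sqrt ht.le]
    have : -(x / Real.sqrt t) * (Real.sqrt t * s) = -x * s := by field_simp
    rw [this]; ring_nf
  rw [h2] at h
  change _ = _ * heatIntegral p (x / Real.sqrt t) 1 at h
  have e : t ^ (p / 2) = Real.sqrt t ^ p := by
    rw [Real.sqrt_eq_rpow, ← Real.rpow_mul ht.le]; congr 1; ring
  have e2 : Real.sqrt t ^ p * Real.sqrt t ^ (-p - 1) = (Real.sqrt t)⁻¹ := by
    rw [← Real.rpow_add hst, ← Real.rpow_neg_one]; congr 1; ring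
  have hpos : 0 < Real.sqrt t ^ p := Real.rpow_pos_of_pos hst _
  rw [e]
  have h3 : (Real.sqrt t)⁻¹ * heatIntegral p x t
      = (Real.sqrt t)⁻¹ * (Real.sqrt t ^ p * heatIntegral p (x / Real.sqrt t) 1) := by
    rw [← e2]
    calc _ = Real.sqrt t ^ p * (Real.sqrt t ^ (-p - 1) * heatIntegral p x t) := by ring
      _ = _ := by rw [h, ← e2]; ring
  exact mul_left_cancel₀ (inv_ne_zero hst.ne') h3

theorem V_eq_heatIntegral {p t : ℝ} (hp0 : 0 < p) (hp1 : p < 1) (x : ℝ) (ht : 0 < t) :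
    V p x t = p / Real.Gamma (1 - p) * heatIntegral p x t := by
  rw [V, if_neg ht.ne', psi_eq_heatIntegral hp0 hp1, heatIntegral_scale x ht]
  ring

theorem psi_strictMono {p : ℝ} (hp0 : 0 < p) (hp1 : p < 1) : StrictMono (psi p) := by
  intro x y hxy
  have hK : 0 < p / Real.Gamma (1 - p) := div_pos hp0 (Real.Gamma_pos_of_pos (by linarith))
  rw [psi_eq_heatIntegral hp0 hp1, psi_eq_heatIntegral hp0 hp1]
  refine mul_lt_mul_of_pos_left ?_ hK
  have ix := integrableOn_heatIntegral hp0 hp1 x one_pos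
  have iy := integrableOn_heatIntegral hp0 hp1 y one_pos
  rw [← sub_pos, heatIntegral, heatIntegral, ← integral_sub iy ix]
  have hpos : ∀ s : ℝ, s ∈ Ioi (0 : ℝ) →
      0 < s ^ (-p - 1) * (1 - Real.exp (-y * s - 1 * s ^ 2 / 2))
        - s ^ (-p - 1) * (1 - Real.exp (-x * s - 1 * s ^ 2 / 2)) := by
    intro s hs
    have hs : 0 < s := hs
    rw [← mul_sub]
    refine mul_pos (by positivity) ?_
    have : Real.exp (-y * s - 1 * s ^ 2 / 2) < Real.exp (-x * s - 1 * s ^ 2 / 2) :=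
      Real.exp_lt_exp.2 (by nlinarith)
    linarith
  refine (setIntegral_pos_iff_support_of_nonneg_ae ?_ (iy.sub ix)).2 ?_
  · filter_upwards [ae_restrict_mem measurableSet_Ioi] with s hs
    exact (hpos s hs).le
  · exact lt_of_lt_of_le (by simp : 0 < volume (Ioi (0 : ℝ)))
      (measure_mono fun s hs => ⟨(hpos s hs).ne', hs⟩)

theorem psi_zero_nonneg {p : ℝ} (hp0 : 0 < p) (hp1 : p < 1) : 0 ≤ psi p 0 := by
  rw [psi_eq_heatIntegral hp0 hp1]
  refine mul_nonneg (div_nonneg hp0.le (Real.Gamma_pos_of_pos (by linarith)).le) ?_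
  refine setIntegral_nonneg measurableSet_Ioi fun s hs => ?_
  have hs : 0 < s := hs
  have : Real.exp (-0 * s - 1 * s ^ 2 / 2) ≤ 1 :=
    Real.exp_le_one_iff.2 (by nlinarith [sq_nonneg s])
  exact mul_nonneg (by positivity) (by linarith)

theorem psi_pos_of_cRoot_lt {p x : ℝ} (hp0 : 0 < p) (hp1 : p < 1) (hx : cRoot p < x) :
    0 < psi p x := by
  have hmono := psi_strictMono hp0 hp1
  by_cases h : ∃ z, psi p z = 0
  · obtain ⟨z, hz⟩ := h
    have hset : {x : ℝ | psi p x = 0} = {z} := by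
      ext w
      exact ⟨fun hw => hmono.injective (Eq.trans hw hz.symm), fun hw => by rw [hw]; exact hz⟩
    rw [cRoot, hset, csSup_singleton] at hx
    rw [← hz]; exact hmono hx
  · have hset : {x : ℝ | psi p x = 0} = ∅ := by
      ext w; exact ⟨fun hw => h ⟨w, hw⟩, fun hw => hw.elim⟩
    rw [cRoot, hset, Real.sSup_empty] at hx
    exact (psi_zero_nonneg hp0 hp1).trans_lt (hmono hx)

theorem abs_rpow_two_add_le {δ : ℝ} (hδ0 : 0 < δ) (hδ1 : δ < 1) {X s : ℝ} (hs : 0 < s) :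
    |X * s + s ^ 2 / 2| ^ (2 + δ)
      ≤ 8 * (|X| ^ (2 + δ) * s ^ (2 + δ)) + 8 * s ^ (4 + 2 * δ) := by
  have e1 : |X| ^ (2 + δ) * s ^ (2 + δ) = (|X| * s) ^ (2 + δ) :=
    (Real.mul_rpow (abs_nonneg _) hs.le).symm
  have e2 : s ^ (4 + 2 * δ) = (s ^ 2) ^ (2 + δ) := by
    rw [← Real.rpow_two, ← Real.rpow_mul hs.le]; congr 1; ring
  have h1 : |X * s + s ^ 2 / 2| ≤ 2 * max (|X| * s) (s ^ 2) := by
    calc _ ≤ |X * s| + |s ^ 2 / 2| := abs_add_le _ _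
      _ = |X| * s + s ^ 2 / 2 := by
        rw [abs_mul, abs_of_pos hs, abs_of_nonneg (by positivity : 0 ≤ s ^ 2 / 2)]
      _ ≤ _ := by
        linarith [le_max_left (|X| * s) (s ^ 2), le_max_right (|X| * s) (s ^ 2), sq_nonneg s]
  have hX : 0 ≤ |X| * s := by positivity
  have h8 : (2 : ℝ) ^ (2 + δ) ≤ 8 := by
    calc (2 : ℝ) ^ (2 + δ) ≤ 2 ^ (3 : ℝ) :=
          Real.rpow_le_rpow_of_exponent_le one_le_two (by linarith)
      _ = 8 := by norm_num
  have hm : (max (|X| * s) (s ^ 2)) ^ (2 + δ) ≤ (|X| * s) ^ (2 + δ) + (s ^ 2) ^ (2 + δ) := by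
    rcases max_cases (|X| * s) (s ^ 2) with ⟨h, -⟩ | ⟨h, -⟩ <;> rw [h]
    · exact le_add_of_nonneg_right (by positivity)
    · exact le_add_of_nonneg_left (by positivity)
  rw [e1, e2, ← mul_add]
  calc _ ≤ (2 * max (|X| * s) (s ^ 2)) ^ (2 + δ) :=
        Real.rpow_le_rpow (abs_nonneg _) h1 (by linarith)
    _ = 2 ^ (2 + δ) * (max (|X| * s) (s ^ 2)) ^ (2 + δ) :=
        Real.mul_rpow two_pos.le (le_max_of_le_left hX)
    _ ≤ _ := by gcongr

theorem one_sub_exp_neg_le {δ : ℝ} (hδ0 : 0 < δ) (hδ1 : δ < 1) (u : ℝ) :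
    1 - Real.exp (-u) ≤ u - u ^ 2 / 2 + |u| ^ (2 + δ) := by
  rcases le_total |u| 1 with h | h
  · have hb := Real.exp_bound (x := -u) (by rwa [abs_neg]) (n := 3) (by norm_num)
    simp [Finset.sum_range_succ, Nat.factorial] at hb
    have h3 : |u| ^ 3 ≤ |u| ^ (2 + δ) := by
      rcases (abs_nonneg u).eq_or_lt with h0 | h0
      · rw [← h0]; simp; positivity
      · rw [← Real.rpow_natCast]
        exact Real.rpow_le_rpow_of_exponent_ge h0 h (by norm_num; linarith)
    have h4 : 0 ≤ |u| ^ 3 := by positivity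
    linarith [(abs_le.1 hb).1]
  · have h1 := Real.add_one_le_exp (-u)
    have h2 : |u| ^ (2 : ℝ) ≤ |u| ^ (2 + δ) :=
      Real.rpow_le_rpow_of_exponent_le h (by linarith)
    rw [Real.rpow_two, sq_abs] at h2
    nlinarith [sq_nonneg u]

/-- Second-order expansion of `1 - exp(-Xs - s²/2)`, valid for all real `X`. -/
theorem one_sub_exp_step_le {δ : ℝ} (hδ0 : 0 < δ) (hδ1 : δ < 1) (X : ℝ) {s : ℝ} (hs : 0 < s) :
    1 - Real.exp (-X * s - s ^ 2 / 2)
      ≤ X * s + (1 - X ^ 2) / 2 * s ^ 2 + |X| / 2 * s ^ 3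
        + 8 * |X| ^ (2 + δ) * s ^ (2 + δ) + 8 * s ^ (4 + 2 * δ) := by
  have h1 := one_sub_exp_neg_le hδ0 hδ1 (X * s + s ^ 2 / 2)
  have h2 := abs_rpow_two_add_le hδ0 hδ1 (X := X) hs
  have e : -(X * s + s ^ 2 / 2) = -X * s - s ^ 2 / 2 := by ring
  rw [e] at h1
  have h3 : -|X| * s ^ 3 ≤ X * s ^ 3 :=
    mul_le_mul_of_nonneg_right (neg_abs_le X) (by positivity)
  nlinarith [sq_nonneg (s ^ 2)]

theorem heatIntegral_step_le {p δ y τ : ℝ} (hp0 : 0 < p) (hp1 : p < 1) (hδ0 : 0 < δ)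
    (hδ1 : δ < 1) (hτ : 0 < τ) (X : ℝ) :
    heatIntegral p (y + X) (τ + 1) ≤ heatIntegral p y τ
      + (X * gaussMoment (-p) y τ + (1 - X ^ 2) / 2 * gaussMoment (1 - p) y τ
        + |X| / 2 * gaussMoment (2 - p) y τ
        + 8 * |X| ^ (2 + δ) * gaussMoment (1 + δ - p) y τ
        + 8 * gaussMoment (3 + 2 * δ - p) y τ) := by
  have ia := integrableOn_heatIntegral hp0 hp1 (y + X) (by linarith : 0 < τ + 1)
  have ib := integrableOn_heatIntegral hp0 hp1 y hτ
  have i1 := (integrableOn_gaussMoment (r := -p) y (by linarith) hτ).const_mul X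
  have i2 := (integrableOn_gaussMoment (r := 1 - p) y (by linarith) hτ).const_mul ((1 - X ^ 2) / 2)
  have i3 := (integrableOn_gaussMoment (r := 2 - p) y (by linarith) hτ).const_mul (|X| / 2)
  have i4 := (integrableOn_gaussMoment (r := 1 + δ - p) y (by linarith) hτ).const_mul
    (8 * |X| ^ (2 + δ))
  have i5 := (integrableOn_gaussMoment (r := 3 + 2 * δ - p) y (by linarith) hτ).const_mul 8
  simp only [gaussMoment, heatIntegral]
  simp only [← integral_const_mul]
  rw [← integral_add' i1 i2, ← integral_add' (i1.add i2) i3,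
    ← integral_add' ((i1.add i2).add i3) i4, ← integral_add' (((i1.add i2).add i3).add i4) i5,
    ← integral_add' ib ((((i1.add i2).add i3).add i4).add i5)]
  refine setIntegral_mono_on ia (ib.add ((((i1.add i2).add i3).add i4).add i5))
    measurableSet_Ioi fun s hs => ?_
  have hs : 0 < s := hs
  have hE : Real.exp (-(y + X) * s - (τ + 1) * s ^ 2 / 2)
      = Real.exp (-y * s - τ * s ^ 2 / 2) * Real.exp (-X * s - s ^ 2 / 2) := by
    rw [← Real.exp_add]; congr 1; ring
  have hpow : ∀ k : ℝ, s ^ (k - p) = s ^ (-p - 1) * s ^ (k + 1) := fun k => by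
    rw [← Real.rpow_add hs]; congr 1; ring
  have e1 : s ^ (-p) = s ^ (-p - 1) * s := by rw [Real.rpow_sub_one hs.ne']; field_simp
  have e2 : s ^ (1 - p) = s ^ (-p - 1) * s ^ 2 := by
    rw [hpow, ← Real.rpow_natCast]; norm_num
  have e3 : s ^ (2 - p) = s ^ (-p - 1) * s ^ 3 := by
    rw [hpow, ← Real.rpow_natCast]; norm_num
  have e4 : s ^ (1 + δ - p) = s ^ (-p - 1) * s ^ (2 + δ) := by
    rw [hpow]; congr 2; ring
  have e5 : s ^ (3 + 2 * δ - p) = s ^ (-p - 1) * s ^ (4 + 2 * δ) := by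
    rw [hpow]; congr 2; ring
  have key := mul_le_mul_of_nonneg_left (one_sub_exp_step_le hδ0 hδ1 X hs)
    (by positivity : 0 ≤ s ^ (-p - 1) * Real.exp (-y * s - τ * s ^ 2 / 2))
  simp only [Pi.add_apply, hE, e1, e2, e3, e4, e5]
  linarith

theorem rpow_sub_one_le_rpow_add_one_sub {q τ : ℝ} (hq0 : 0 < q) (hq1 : q < 1) (hτ : 1 ≤ τ) :
    q / 2 * τ ^ (q - 1) ≤ (τ + 1) ^ q - τ ^ q := by
  have hτ1 : 0 < τ + 1 := by linarith
  have h := rpow_one_add_le_one_add_mul_self (s := -(1 / (τ + 1))) (p := q)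
    (by rw [neg_le_neg_iff, div_le_one hτ1]; linarith) hq0.le hq1.le
  have e : τ ^ q = (τ + 1) ^ q * (1 + -(1 / (τ + 1))) ^ q := by
    rw [← Real.mul_rpow hτ1.le]
    · congr 1; field_simp; ring
    · have : 1 / (τ + 1) ≤ 1 := by rw [div_le_one hτ1]; linarith
      linarith
  have h2 : τ ^ q ≤ (τ + 1) ^ q - q * (τ + 1) ^ (q - 1) := by
    rw [e, Real.rpow_sub_one hτ1.ne']
    calc _ ≤ (τ + 1) ^ q * (1 + q * -(1 / (τ + 1))) := by gcongr
      _ = _ := by field_simp; ring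
  have h3 : 1 / 2 * τ ^ (q - 1) ≤ (τ + 1) ^ (q - 1) := by
    calc 1 / 2 * τ ^ (q - 1) ≤ 2 ^ (q - 1) * τ ^ (q - 1) := by
          gcongr
          calc (1 / 2 : ℝ) = 2 ^ (-1 : ℝ) := by rw [Real.rpow_neg_one]; norm_num
            _ ≤ _ := Real.rpow_le_rpow_of_exponent_le one_le_two (by linarith)
      _ = (2 * τ) ^ (q - 1) := (Real.mul_rpow two_pos.le (by linarith)).symm
      _ ≤ _ := Real.rpow_le_rpow_of_nonpos hτ1 (by linarith) (by linarith)
  nlinarith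

theorem rpow_le_of_sqrt_le_abs {j k ε τ X : ℝ} (hk : 0 ≤ k) (hε : 0 < ε) (hτ : 0 < τ)
    (hX : ε * Real.sqrt τ ≤ |X|) :
    |X| ^ j ≤ ε ^ (-k) * τ ^ (-k / 2) * |X| ^ (j + k) := by
  have hpos : 0 < ε * Real.sqrt τ := mul_pos hε (Real.sqrt_pos.2 hτ)
  have hX0 : 0 < |X| := hpos.trans_le hX
  have e1 : |X| ^ j = |X| ^ (-k) * |X| ^ (j + k) := by
    rw [← Real.rpow_add hX0]; congr 1; ring
  have e2 : ε ^ (-k) * τ ^ (-k / 2) = (ε * Real.sqrt τ) ^ (-k) := by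
    rw [Real.mul_rpow hε.le (Real.sqrt_nonneg _), Real.sqrt_eq_rpow, ← Real.rpow_mul hτ.le]
    congr 2; ring
  rw [e1, e2]
  exact mul_le_mul_of_nonneg_right (Real.rpow_le_rpow_of_nonpos hpos hX (by linarith))
    (by positivity)

/-- One-step upper bound for `V_p(y + X, τ + 1)`, together with nonnegativity of the error term
(minus the martingale part) for large negative `X`. -/
theorem exists_heatIntegral_step_bound {p δ ε : ℝ} (hp0 : 0 < p) (hp1 : p < 1) (hδ0 : 0 < δ)
    (hδ1 : δ < 1) (hε : 0 < ε) (b : ℝ) :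
    ∃ N : ℝ, 0 ≤ N ∧ ∀ τ y X : ℝ, 1 ≤ τ → b * Real.sqrt τ ≤ y →
      (heatIntegral p (y + X) (τ + 1) ≤ heatIntegral p y τ
        + (X * gaussMoment (-p) y τ + (1 - X ^ 2) / 2 * gaussMoment (1 - p) y τ)
        + N * τ ^ ((p - δ) / 2 - 1) * (1 + |X| ^ (2 + δ))) ∧
      (X ≤ -(ε * Real.sqrt τ) →
        0 ≤ (X * gaussMoment (-p) y τ + (1 - X ^ 2) / 2 * gaussMoment (1 - p) y τ)
        + N * τ ^ ((p - δ) / 2 - 1) * (1 + |X| ^ (2 + δ))) := by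
  obtain ⟨A₁, hA₁, h₁⟩ := exists_gaussMoment_le (r := -p) (by linarith) b
  obtain ⟨A₂, hA₂, h₂⟩ := exists_gaussMoment_le (r := 1 - p) (by linarith) b
  obtain ⟨A₃, hA₃, h₃⟩ := exists_gaussMoment_le (r := 2 - p) (by linarith) b
  obtain ⟨A₄, hA₄, h₄⟩ := exists_gaussMoment_le (r := 1 + δ - p) (by linarith) b
  obtain ⟨A₅, hA₅, h₅⟩ := exists_gaussMoment_le (r := 3 + 2 * δ - p) (by linarith) b
  refine ⟨(A₃ + 8 * A₄ + 8 * A₅) + (A₁ * ε ^ (-(1 + δ)) + A₂ * ε ^ (-δ)), by positivity,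
    fun τ y X hτ hy => ?_⟩
  have hτ0 : 0 < τ := by linarith
  set T := τ ^ ((p - δ) / 2 - 1) with hT
  set Y := |X| ^ (2 + δ) with hY
  have hT0 : 0 ≤ T := by positivity
  have hY0 : 0 ≤ Y := by positivity
  have hB₁ : 0 ≤ A₁ * ε ^ (-(1 + δ)) := by positivity
  have hB₂ : 0 ≤ A₂ * ε ^ (-δ) := by positivity
  have hTY : 0 ≤ T * Y := mul_nonneg hT0 hY0
  have hexp : ∀ r : ℝ, -(r + 1) / 2 ≤ (p - δ) / 2 - 1 → τ ^ (-(r + 1) / 2) ≤ T := fun r hr =>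
    Real.rpow_le_rpow_of_exponent_le hτ hr
  have m₁ := h₁ τ y hτ0 hy
  have m₂ := h₂ τ y hτ0 hy
  have m₃ : gaussMoment (2 - p) y τ ≤ A₃ * T :=
    (h₃ τ y hτ0 hy).trans (mul_le_mul_of_nonneg_left (hexp _ (by linarith)) hA₃)
  have m₄ : gaussMoment (1 + δ - p) y τ ≤ A₄ * T :=
    (h₄ τ y hτ0 hy).trans (mul_le_mul_of_nonneg_left (hexp _ (by linarith)) hA₄)
  have m₅ : gaussMoment (3 + 2 * δ - p) y τ ≤ A₅ * T :=
    (h₅ τ y hτ0 hy).trans (mul_le_mul_of_nonneg_left (hexp _ (by linarith)) hA₅)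
  have hN₁ : 0 ≤ (A₃ + 8 * A₄ + 8 * A₅) * T * (1 + Y) := by positivity
  have hN₂ : 0 ≤ (A₁ * ε ^ (-(1 + δ)) + A₂ * ε ^ (-δ)) * T := by positivity
  constructor
  · have hstep := heatIntegral_step_le (y := y) hp0 hp1 hδ0 hδ1 hτ0 X
    have hX1 : |X| ≤ 1 + Y := by
      rcases le_total |X| 1 with h | h
      · linarith
      · have : |X| ^ (1 : ℝ) ≤ Y := Real.rpow_le_rpow_of_exponent_le h (by linarith)
        rw [Real.rpow_one] at this; linarith
    have t₃ : |X| / 2 * gaussMoment (2 - p) y τ ≤ (1 + Y) * (A₃ * T) := by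
      gcongr
      · exact gaussMoment_nonneg _ _ _
      · linarith [abs_nonneg X]
    have t₄ : 8 * Y * gaussMoment (1 + δ - p) y τ ≤ 8 * (1 + Y) * (A₄ * T) := by
      gcongr
      · exact gaussMoment_nonneg _ _ _
      · linarith
    have t₅ : 8 * gaussMoment (3 + 2 * δ - p) y τ ≤ 8 * (1 + Y) * (A₅ * T) := by
      have : (0 : ℝ) ≤ A₅ * T * Y := by positivity
      linarith
    have hN₂' := mul_nonneg hN₂ (by linarith : 0 ≤ 1 + Y)
    linarith
  · intro hX
    have hX' : ε * Real.sqrt τ ≤ |X| := by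
      linarith [neg_le_abs X]
    have r₁ := rpow_le_of_sqrt_le_abs (j := 1) (k := 1 + δ) (by linarith) hε hτ0 hX'
    have r₂ := rpow_le_of_sqrt_le_abs (j := 2) (k := δ) hδ0.le hε hτ0 hX'
    rw [Real.rpow_one, show (1 : ℝ) + (1 + δ) = 2 + δ by ring] at r₁
    rw [Real.rpow_two, sq_abs] at r₂
    have t₁ : |X| * gaussMoment (-p) y τ ≤ A₁ * ε ^ (-(1 + δ)) * (T * Y) := by
      have e : T = τ ^ (-(1 + δ) / 2) * τ ^ (-(-p + 1) / 2) := by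
        rw [← Real.rpow_add hτ0]; rw [hT]; congr 1; ring
      calc _ ≤ (ε ^ (-(1 + δ)) * τ ^ (-(1 + δ) / 2) * Y) * (A₁ * τ ^ (-(-p + 1) / 2)) :=
            mul_le_mul r₁ m₁ (gaussMoment_nonneg _ _ _) (by positivity)
        _ = _ := by rw [e]; ring
    have t₂ : X ^ 2 * gaussMoment (1 - p) y τ ≤ A₂ * ε ^ (-δ) * (T * Y) := by
      have e : T = τ ^ (-δ / 2) * τ ^ (-(1 - p + 1) / 2) := by
        rw [← Real.rpow_add hτ0]; rw [hT]; congr 1; ring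
      calc _ ≤ (ε ^ (-δ) * τ ^ (-δ / 2) * Y) * (A₂ * τ ^ (-(1 - p + 1) / 2)) :=
            mul_le_mul r₂ m₂ (gaussMoment_nonneg _ _ _) (by positivity)
        _ = _ := by rw [e]; ring
    have g₁ := mul_le_mul_of_nonneg_right (neg_abs_le X) (gaussMoment_nonneg (-p) y τ)
    have g₂ := gaussMoment_nonneg (1 - p) y τ
    have g₃ := mul_nonneg (sq_nonneg X) g₂
    linarith

theorem rpow_mul_psi_le_V {p b z σ : ℝ} (hp0 : 0 < p) (hp1 : p < 1) (hσ : 0 < σ)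
    (hz : b * Real.sqrt σ ≤ z) : σ ^ (p / 2) * psi p b ≤ V p z σ := by
  rw [V, if_neg hσ.ne']
  refine mul_le_mul_of_nonneg_left ((psi_strictMono hp0 hp1).monotone ?_) (by positivity)
  rwa [le_div_iff₀ (Real.sqrt_pos.2 hσ)]

theorem exists_large_shift {δ : ℝ} (hδ0 : 0 < δ) {γ ψ : ℝ} (hγ : 0 < γ) (hψ : 0 < ψ)
    (a b C : ℝ) :
    ∃ R : ℝ, 1 ≤ R ∧ a ≤ R ∧ b ≤ γ * Real.sqrt R ∧ 2 * C ≤ R ^ (δ / 2) * ψ := by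
  have h1 := (Real.tendsto_sqrt_atTop.const_mul_atTop hγ).eventually_ge_atTop b
  have h2 := ((tendsto_rpow_atTop (half_pos hδ0)).atTop_mul_const hψ).eventually_ge_atTop (2 * C)
  obtain ⟨R, ⟨⟨hR1, hR2⟩, hR3⟩, hR4⟩ :=
    (((eventually_ge_atTop 1).and (eventually_ge_atTop a)).and h1 |>.and h2).exists
  exact ⟨R, hR1, hR2, hR3, hR4⟩

theorem sqrt_add_le_sqrt_add_sqrt {a b : ℝ} (ha : 0 ≤ a) (hb : 0 ≤ b) :
    Real.sqrt (a + b) ≤ Real.sqrt a + Real.sqrt b :=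
  Real.sqrt_le_iff.2 ⟨by positivity, by
    nlinarith [Real.sq_sqrt ha, Real.sq_sqrt hb,
      mul_nonneg (Real.sqrt_nonneg a) (Real.sqrt_nonneg b)]⟩

theorem mul_sqrt_add_le {d t x R : ℝ} (ht : 0 ≤ t) (hR : 0 < R) (hdR : d ^ 2 ≤ R)
    (hx : d * Real.sqrt t ≤ x) : d * Real.sqrt (t + R) ≤ x + R := by
  rcases le_total 0 d with hd | hd
  · have h1 : Real.sqrt (t + R) ≤ Real.sqrt t + Real.sqrt R :=
      sqrt_add_le_sqrt_add_sqrt ht hR.le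
    have h2 : d ≤ Real.sqrt R := Real.le_sqrt_of_sq_le hdR
    nlinarith [Real.mul_self_sqrt hR.le, Real.sqrt_nonneg R,
      mul_le_mul_of_nonneg_left h1 hd, mul_le_mul_of_nonneg_right h2 (Real.sqrt_nonneg R)]
  · have h1 : Real.sqrt t ≤ Real.sqrt (t + R) := Real.sqrt_le_sqrt (by linarith)
    nlinarith

theorem mul_sqrt_add_one_le {c γ τ R y u : ℝ} (hγ : 0 ≤ γ) (hτ : 0 ≤ τ) (hRτ : R ≤ τ)
    (hR : |c + γ / 2| ≤ γ / 4 * Real.sqrt R) (hy : (c + γ) * Real.sqrt τ ≤ y)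
    (hu : -(γ / 4 * Real.sqrt τ) ≤ u) : (c + γ / 2) * Real.sqrt (τ + 1) ≤ y + u := by
  have h1 : Real.sqrt (τ + 1) - Real.sqrt τ ≤ 1 := by
    have := sqrt_add_le_sqrt_add_sqrt hτ zero_le_one
    rw [Real.sqrt_one] at this; linarith
  have h2 : 0 ≤ Real.sqrt (τ + 1) - Real.sqrt τ :=
    sub_nonneg.2 (Real.sqrt_le_sqrt (by linarith))
  have h3 : γ / 4 * Real.sqrt R ≤ γ / 4 * Real.sqrt τ :=
    mul_le_mul_of_nonneg_left (Real.sqrt_le_sqrt hRτ) (by linarith)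
  have h4 : (c + γ / 2) * (Real.sqrt (τ + 1) - Real.sqrt τ) ≤ |c + γ / 2| :=
    (mul_le_mul_of_nonneg_right (le_abs_self _) h2).trans
      (mul_le_of_le_one_right (abs_nonneg _) h1)
  linarith

theorem mul_rpow_le_V {p δ b z τ σ R C : ℝ} (hp0 : 0 < p) (hp1 : p < 1) (hδ0 : 0 < δ)
    (hδ : δ < p) (hC : 0 < C) (hR : 1 ≤ R) (hψ : 0 < psi p b)
    (hRC : 2 * C ≤ R ^ (δ / 2) * psi p b) (hRτ : R ≤ τ) (hσ : τ ≤ σ)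
    (hz : b * Real.sqrt σ ≤ z) : C * (τ + 1) ^ ((p - δ) / 2) ≤ V p z σ := by
  have hτ0 : 0 < τ := by linarith
  calc C * (τ + 1) ^ ((p - δ) / 2) ≤ C * (2 * τ) ^ ((p - δ) / 2) := by
        gcongr
        linarith
    _ = C * (2 ^ ((p - δ) / 2) * τ ^ ((p - δ) / 2)) := by
        rw [Real.mul_rpow two_pos.le hτ0.le]
    _ ≤ C * (2 * τ ^ ((p - δ) / 2)) := by
        gcongr
        calc (2 : ℝ) ^ ((p - δ) / 2) ≤ 2 ^ (1 : ℝ) :=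
              Real.rpow_le_rpow_of_exponent_le one_le_two (by linarith)
          _ = 2 := Real.rpow_one 2
    _ = 2 * C * τ ^ ((p - δ) / 2) := by ring
    _ ≤ (R ^ (δ / 2) * psi p b) * τ ^ ((p - δ) / 2) := by gcongr
    _ ≤ (τ ^ (δ / 2) * psi p b) * τ ^ ((p - δ) / 2) := by gcongr
    _ = τ ^ (p / 2) * psi p b := by
        have : τ ^ (p / 2) = τ ^ (δ / 2) * τ ^ ((p - δ) / 2) := by
          rw [← Real.rpow_add hτ0]; congr 1; ring
        rw [this]; ring
    _ ≤ σ ^ (p / 2) * psi p b := by gcongr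
    _ ≤ _ := rpow_mul_psi_le_V hp0 hp1 (by linarith) hz

/-- Lemma 10: the corrected function `g(x,t) = (V̄_p(x+R,t+R) - C(t+R)^{(p-δ)/2})⁺`
has nonpositive mean drift above the ray `x = (c(p)+γ)√t` (case `p ∈ (0,1)`). -/
theorem corrected_supermartingale_drift_small_p
    [MeasureSpace Ω] [IsProbabilityMeasure (ℙ : Measure Ω)]
    (X : Ω → ℝ) (p δ : ℝ) (hp0 : 0 < p) (hp1 : p < 1) (hδ0 : 0 < δ) (hδ : δ < p)
    (hmeas : Measurable X)
    (hmean : ∫ ω, X ω ∂ℙ = 0)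
    (hvar : ∫ ω, (X ω) ^ 2 ∂ℙ = 1)
    (hmom2δ : Integrable (fun ω => |X ω| ^ (2 + δ)) ℙ)
    (γ : ℝ) (hγ : 0 < γ) :
    ∃ C : ℝ, 0 < C ∧ ∃ R : ℝ, 0 < R ∧
      ∀ t : ℝ, 0 ≤ t → ∀ x : ℝ, (cRoot p + γ) * Real.sqrt t ≤ x →
        (∫ ω, max (Vbar p (x + X ω + R) (t + 1 + R)
            - C * (t + 1 + R) ^ ((p - δ) / 2)) 0 ∂ℙ)
          ≤ max (Vbar p (x + R) (t + R) - C * (t + R) ^ ((p - δ) / 2)) 0 := by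
  have hδ1 : δ < 1 := hδ.trans hp1
  set c := cRoot p with hc
  set b := c + γ / 2 with hb
  have hψ : 0 < psi p b := psi_pos_of_cRoot_lt hp0 hp1 (by linarith)
  set K := p / Real.Gamma (1 - p)
  have hK0 : 0 < K := div_pos hp0 (Real.Gamma_pos_of_pos (by linarith))
  obtain ⟨N, hN, hstep⟩ :=
    exists_heatIntegral_step_bound hp0 hp1 hδ0 hδ1 (ε := γ / 4) (by linarith) b
  set q := (p - δ) / 2 with hq
  have hq0 : 0 < q := by rw [hq]; linarith
  have hq1 : q < 1 := by rw [hq]; linarith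
  set M := ∫ ω, |X ω| ^ (2 + δ) ∂(ℙ : Measure Ω) with hM
  have hM0 : 0 ≤ M := integral_nonneg fun ω => by positivity
  have hX2 : Integrable (fun ω => (X ω) ^ 2) (ℙ : Measure Ω) := by
    by_contra h
    rw [integral_undef h] at hvar
    exact zero_ne_one hvar
  have hX1 : Integrable X (ℙ : Measure Ω) := by
    refine ((integrable_const (1 : ℝ)).add hX2).mono' hmeas.aestronglyMeasurable
      (ae_of_all _ fun ω => ?_)
    simp only [Pi.add_apply, Real.norm_eq_abs]
    rw [abs_le]
    constructor <;> nlinarith [sq_nonneg (X ω - 1), sq_nonneg (X ω + 1)]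
  have hNM : 0 ≤ K * N * (1 + M) := by positivity
  set C := 2 * (K * N * (1 + M)) / q + 1 with hC
  have hC0 : 0 < C := by positivity
  have hCq : K * N * (1 + M) ≤ C * (q / 2) := by
    have : C * (q / 2) = K * N * (1 + M) + q / 2 := by rw [hC]; field_simp
    linarith
  obtain ⟨R, hR1, hR2, hR3, hR4⟩ :=
    exists_large_shift hδ0 (γ := γ / 4) (by linarith) hψ ((c + γ) ^ 2) |b| C
  refine ⟨C, hC0, R, by linarith, fun t ht x hx => ?_⟩
  set τ := t + R with hτ
  set y := x + R with hy
  have hRτ : R ≤ τ := by linarith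
  have hτ1 : 1 ≤ τ := by linarith
  have hsτ : 0 ≤ Real.sqrt τ := Real.sqrt_nonneg _
  have hyd : (c + γ) * Real.sqrt τ ≤ y := mul_sqrt_add_le ht (by linarith) hR2 hx
  have hyb : b * Real.sqrt τ ≤ y := by nlinarith
  have hyc : c * Real.sqrt τ ≤ y := by nlinarith
  have hV : Vbar p y τ = V p y τ := if_pos hyc
  have hVy : C * (τ + 1) ^ q ≤ V p y τ :=
    mul_rpow_le_V hp0 hp1 hδ0 hδ hC0 hR1 hψ hR4 hRτ le_rfl hyb
  set T := τ ^ (q - 1)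
  have hT0 : 0 ≤ T := by positivity
  set m₁ := gaussMoment (-p) y τ
  set m₂ := gaussMoment (1 - p) y τ
  have hpt : ∀ u : ℝ, max (Vbar p (x + u + R) (t + 1 + R) - C * (t + 1 + R) ^ q) 0
      ≤ (V p y τ - C * (τ + 1) ^ q) + K * (u * m₁ + (1 - u ^ 2) / 2 * m₂)
        + K * N * T * (1 + |u| ^ (2 + δ)) := by
    intro u
    rw [show x + u + R = y + u by rw [hy]; ring, show t + 1 + R = τ + 1 by rw [hτ]; ring]
    obtain ⟨hup, hneg⟩ := hstep τ y u hτ1 hyb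
    have hVle : V p (y + u) (τ + 1) - C * (τ + 1) ^ q
        ≤ (V p y τ - C * (τ + 1) ^ q) + K * (u * m₁ + (1 - u ^ 2) / 2 * m₂)
        + K * N * T * (1 + |u| ^ (2 + δ)) := by
      rw [V_eq_heatIntegral hp0 hp1 _ (by linarith : 0 < τ + 1),
        V_eq_heatIntegral hp0 hp1 _ (by linarith : 0 < τ)]
      linarith [mul_le_mul_of_nonneg_left hup hK0.le]
    have hnonneg : 0 ≤ (V p y τ - C * (τ + 1) ^ q) + K * (u * m₁ + (1 - u ^ 2) / 2 * m₂)
        + K * N * T * (1 + |u| ^ (2 + δ)) := by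
      rcases le_total u (-(γ / 4 * Real.sqrt τ)) with h | h
      · linarith [mul_nonneg hK0.le (hneg h)]
      · refine le_trans (sub_nonneg.2 ?_) hVle
        refine mul_rpow_le_V hp0 hp1 hδ0 hδ hC0 hR1 hψ hR4 hRτ (by linarith) 
          (mul_sqrt_add_one_le hγ.le (by linarith) hRτ hR3 hyd h)
    refine max_le ?_ hnonneg
    rw [Vbar]
    split_ifs
    · exact hVle
    · have : 0 ≤ C * (τ + 1) ^ q := by positivity
      linarith
  have iv : Integrable (fun ω => (1 - X ω ^ 2) / 2 * m₂) (ℙ : Measure Ω) :=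
    (((integrable_const 1).sub hX2).div_const 2).mul_const m₂
  have i1 : Integrable (fun ω => K * (X ω * m₁ + (1 - X ω ^ 2) / 2 * m₂)) (ℙ : Measure Ω) :=
    ((hX1.mul_const m₁).add iv).const_mul K
  have i2 : Integrable (fun ω => K * N * T * (1 + |X ω| ^ (2 + δ))) (ℙ : Measure Ω) :=
    ((integrable_const 1).add hmom2δ).const_mul _
  have i0 : Integrable (fun _ : Ω => V p y τ - C * (τ + 1) ^ q) (ℙ : Measure Ω) :=
    integrable_const _
  have i01 : Integrable (fun ω => V p y τ - C * (τ + 1) ^ q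
      + K * (X ω * m₁ + (1 - X ω ^ 2) / 2 * m₂)) (ℙ : Measure Ω) := i0.add i1
  have hmart : ∫ ω, K * (X ω * m₁ + (1 - X ω ^ 2) / 2 * m₂) ∂(ℙ : Measure Ω) = 0 := by
    rw [integral_const_mul, integral_add (hX1.mul_const m₁) iv, integral_mul_const,
      integral_mul_const, integral_div, integral_sub (integrable_const 1) hX2, hmean, hvar]
    simp
  have herr : ∫ ω, K * N * T * (1 + |X ω| ^ (2 + δ)) ∂(ℙ : Measure Ω) = K * N * T * (1 + M) := by
    rw [integral_const_mul, integral_add (integrable_const 1) hmom2δ]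
    simp [hM]
  calc _ ≤ ∫ ω, (V p y τ - C * (τ + 1) ^ q) + K * (X ω * m₁ + (1 - X ω ^ 2) / 2 * m₂)
        + K * N * T * (1 + |X ω| ^ (2 + δ)) ∂(ℙ : Measure Ω) :=
        integral_mono_of_nonneg (ae_of_all _ fun ω => le_max_right _ _) (i01.add i2)
          (ae_of_all _ fun ω => hpt (X ω))
    _ = V p y τ - C * (τ + 1) ^ q + K * N * T * (1 + M) := by
        rw [integral_add i01 i2, integral_add i0 i1, hmart, herr]
        simp
    _ ≤ V p y τ - C * τ ^ q := by
        have h1 := mul_le_mul_of_nonneg_left (rpow_sub_one_le_rpow_add_one_sub hq0 hq1 hτ1) hC0.le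
        have h2 := mul_le_mul_of_nonneg_right hCq hT0
        linarith
    _ ≤ _ := by rw [hV]; exact le_max_left _ _
end
end
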